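/- For every x ∈ ℝ, one has ∫_ℝ log|x−z| dμ_ℝ(z) = log⁺|x|, where log⁺ t = max{log t, 0}. -/

import Mathlib

open MeasureTheory

/-- The measure dμ_ℝ(z) = (1/(π² z))·log|(z+1)/(z−1)| dz on ℝ. -/
noncomputable def muR : Measure ℝ :=
  volume.withDensity fun z => ENNReal.ofReal (1 / (Real.pi ^ 2 * z) * Real.log |(z + 1) / (z - 1)|)

open Real Set

/-- The Poisson kernel of the upper half plane at `a + b i`, without its factor `1 / π`. -/
noncomputable def poissonKer (a b t : ℝ) : ℝ := b / ((t - a) ^ 2 + b ^ 2)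

lemma countable_cos_add_eq_zero (α : ℝ) : {φ : ℝ | cos (φ + α) = 0}.Countable := by
  refine (countable_range fun k : ℤ => (2 * k + 1) * π / 2 - α).mono fun φ hφ => ?_
  obtain ⟨k, hk⟩ := cos_eq_zero_iff.1 hφ
  exact ⟨k, by simp only; linarith⟩

lemma image_add_mul_tan_Ioo (a : ℝ) {b : ℝ} (hb : 0 < b) :
    (fun φ => a + b * tan φ) '' Ioo (-(π / 2)) (π / 2) = univ := by
  refine eq_univ_of_forall fun t => ⟨arctan ((t - a) / b), arctan_mem_Ioo _, ?_⟩
  simp only [tan_arctan]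
  field_simp
  ring

lemma injOn_add_mul_tan_Ioo (a : ℝ) {b : ℝ} (hb : 0 < b) :
    InjOn (fun φ => a + b * tan φ) (Ioo (-(π / 2)) (π / 2)) := by
  intro φ hφ ψ hψ h
  refine injOn_tan hφ hψ ?_
  simpa [hb.ne'] using h

lemma hasDerivWithinAt_add_mul_tan (a b : ℝ) {φ : ℝ} (hφ : φ ∈ Ioo (-(π / 2)) (π / 2)) :
    HasDerivWithinAt (fun φ => a + b * tan φ) (b * (1 / cos φ ^ 2))
      (Ioo (-(π / 2)) (π / 2)) φ :=
  (((hasDerivAt_tan (cos_pos_of_mem_Ioo hφ).ne').const_mul b).const_add a).hasDerivWithinAt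

lemma abs_deriv_mul_poissonKer (a : ℝ) {b : ℝ} (hb : 0 < b) {φ : ℝ}
    (hφ : φ ∈ Ioo (-(π / 2)) (π / 2)) :
    |b * (1 / cos φ ^ 2)| * poissonKer a b (a + b * tan φ) = 1 := by
  have hc := cos_pos_of_mem_Ioo hφ
  rw [abs_of_pos (by positivity), poissonKer, tan_eq_sin_div_cos]
  have h2 : (a + b * (sin φ / cos φ) - a) ^ 2 + b ^ 2 = b ^ 2 / cos φ ^ 2 := by
    field_simp
    linear_combination b ^ 2 * sin_sq_add_cos_sq φ
  rw [h2]
  field_simp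

/-- In the angular coordinate `t = a + b tan φ`, the function `log |x - t|` is a difference of
translates of `log |cos|`, up to a constant. -/
lemma log_sub_add_mul_tan (a x : ℝ) {b : ℝ} (hb : 0 < b) {φ : ℝ}
    (hφ : φ ∈ Ioo (-(π / 2)) (π / 2))
    (h0 : cos (φ + (⟨x - a, b⟩ : ℂ).arg) ≠ 0) :
    log |x - (a + b * tan φ)| =
      log ‖(⟨x - a, b⟩ : ℂ)‖ + log (cos (φ + (⟨x - a, b⟩ : ℂ).arg)) - log (cos φ) := by
  have hc := cos_pos_of_mem_Ioo hφ
  set z : ℂ := ⟨x - a, b⟩ with hz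
  have hz0 : ‖z‖ ≠ 0 := by
    rw [norm_ne_zero_iff]
    intro h
    exact hb.ne' (congrArg Complex.im h)
  have h1 : ‖z‖ * cos z.arg = x - a := Complex.norm_mul_cos_arg z
  have h2 : ‖z‖ * sin z.arg = b := Complex.norm_mul_sin_arg z
  have h3 : x - (a + b * tan φ) = ‖z‖ * cos (φ + z.arg) / cos φ := by
    rw [tan_eq_sin_div_cos, cos_add]
    field_simp
    linear_combination (-cos φ) * h1 + sin φ * h2
  rw [h3, log_abs, log_div (mul_ne_zero hz0 h0) hc.ne', log_mul hz0 h0]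

lemma integrableOn_log_cos_add (α : ℝ) :
    IntegrableOn (fun φ => log (cos (φ + α))) (Ioo (-(π / 2)) (π / 2)) := by
  have h := (intervalIntegrable_log_cos (a := -(π / 2) + α) (b := π / 2 + α)).comp_add_right α
  simp only [add_sub_cancel_right, Function.comp_def] at h
  exact ((intervalIntegrable_iff_integrableOn_Ioo_of_le (by linarith [pi_pos])).1 h)

/-- Translation invariance of the integral of a function of `log |cos|` over a period. -/
lemma integral_comp_log_cos_add (g : ℝ → ℝ) (α : ℝ) :
    ∫ φ in Ioo (-(π / 2)) (π / 2), g (log (cos (φ + α))) =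
      ∫ φ in Ioo (-(π / 2)) (π / 2), g (log (cos φ)) := by
  have hper : Function.Periodic (fun φ => g (log (cos φ))) π := fun φ => by
    simp only [cos_add_pi, log_neg_eq_log]
  have hle : -(π / 2) ≤ π / 2 := by linarith [pi_pos]
  rw [← integral_Ioc_eq_integral_Ioo, ← integral_Ioc_eq_integral_Ioo,
    ← intervalIntegral.integral_of_le hle, ← intervalIntegral.integral_of_le hle,
    intervalIntegral.integral_comp_add_right (fun φ => g (log (cos φ)))]
  convert hper.intervalIntegral_add_eq (-(π / 2) + α) (-(π / 2)) using 2 <;> ring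

lemma ae_deriv_smul_comp_log_mul_poissonKer (g : ℝ → ℝ) (a x : ℝ) {b : ℝ} (hb : 0 < b) :
    (fun φ => |b * (1 / cos φ ^ 2)| •
        (g (log |x - (a + b * tan φ)|) * poissonKer a b (a + b * tan φ)))
      =ᵐ[volume.restrict (Ioo (-(π / 2)) (π / 2))]
    fun φ => g (log ‖(⟨x - a, b⟩ : ℂ)‖ + log (cos (φ + (⟨x - a, b⟩ : ℂ).arg)) - log (cos φ)) := by
  filter_upwards [ae_restrict_mem measurableSet_Ioo,
    ae_restrict_of_ae ((countable_cos_add_eq_zero (⟨x - a, b⟩ : ℂ).arg).ae_notMem volume)]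
    with φ hφ h0
  rw [smul_eq_mul, mul_left_comm, abs_deriv_mul_poissonKer a hb hφ, mul_one,
    log_sub_add_mul_tan a x hb hφ h0]

lemma integral_comp_log_mul_poissonKer (g : ℝ → ℝ) (a x : ℝ) {b : ℝ} (hb : 0 < b) :
    ∫ t, g (log |x - t|) * poissonKer a b t =
      ∫ φ in Ioo (-(π / 2)) (π / 2),
        g (log ‖(⟨x - a, b⟩ : ℂ)‖ + log (cos (φ + (⟨x - a, b⟩ : ℂ).arg)) - log (cos φ)) := by
  rw [← setIntegral_univ, ← image_add_mul_tan_Ioo a hb,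
    integral_image_eq_integral_abs_deriv_smul measurableSet_Ioo
      (fun φ hφ => hasDerivWithinAt_add_mul_tan a b hφ) (injOn_add_mul_tan_Ioo a hb)]
  exact integral_congr_ae (ae_deriv_smul_comp_log_mul_poissonKer g a x hb)

lemma integrable_log_mul_poissonKer (a x : ℝ) {b : ℝ} (hb : 0 < b) :
    Integrable fun t => log |x - t| * poissonKer a b t := by
  rw [← integrableOn_univ, ← image_add_mul_tan_Ioo a hb,
    integrableOn_image_iff_integrableOn_abs_deriv_smul measurableSet_Ioo
      (fun φ hφ => hasDerivWithinAt_add_mul_tan a b hφ) (injOn_add_mul_tan_Ioo a hb)]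
  refine Integrable.congr ?_ (ae_deriv_smul_comp_log_mul_poissonKer id a x hb).symm
  have h := integrableOn_log_cos_add 0
  simp only [add_zero] at h
  exact ((integrable_const _).add (integrableOn_log_cos_add _)).sub h

/-- The Poisson integral formula for `log |x - ·|` on the upper half plane. -/
lemma integral_log_mul_poissonKer (a x : ℝ) {b : ℝ} (hb : 0 < b) :
    ∫ t, log |x - t| * poissonKer a b t = π * log ‖(⟨x - a, b⟩ : ℂ)‖ := by
  have h := integral_comp_log_mul_poissonKer id a x hb
  have h0 := integrableOn_log_cos_add 0
  simp only [add_zero] at h0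
  have h1 := integrableOn_log_cos_add (⟨x - a, b⟩ : ℂ).arg
  have h2 := integral_comp_log_cos_add id (⟨x - a, b⟩ : ℂ).arg
  simp only [id] at h h2
  have h3 : IntegrableOn (fun φ => log ‖(⟨x - a, b⟩ : ℂ)‖ +
      log (cos (φ + (⟨x - a, b⟩ : ℂ).arg))) (Ioo (-(π / 2)) (π / 2)) :=
    (integrable_const _).add h1
  rw [h, integral_sub h3 h0, integral_add (integrable_const _) h1, h2]
  simp [pi_pos.le]

lemma integral_abs_log_mul_poissonKer_le (a x : ℝ) {b : ℝ} (hb : 0 < b) :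
    ∫ t, |log (|x - t|)| * poissonKer a b t ≤
      π * |log ‖(⟨x - a, b⟩ : ℂ)‖| + 2 * ∫ φ in Ioo (-(π / 2)) (π / 2), |log (cos φ)| := by
  have h := integral_comp_log_mul_poissonKer abs a x hb
  have h0 := integrableOn_log_cos_add 0
  simp only [add_zero] at h0
  have h1 := integrableOn_log_cos_add (⟨x - a, b⟩ : ℂ).arg
  have h2 := integral_comp_log_cos_add abs (⟨x - a, b⟩ : ℂ).arg
  rw [h]
  refine (integral_mono (((integrable_const _).add h1).sub h0).abs
    (((integrable_const |log ‖(⟨x - a, b⟩ : ℂ)‖|).add h1.abs).add h0.abs)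
    fun φ => (abs_sub _ _).trans (add_le_add_left (abs_add_le _ _) _)).trans ?_
  have h3 : IntegrableOn (fun φ => |log ‖(⟨x - a, b⟩ : ℂ)‖| +
      |log (cos (φ + (⟨x - a, b⟩ : ℂ).arg))|) (Ioo (-(π / 2)) (π / 2)) :=
    (integrable_const _).add h1.abs
  simp only [Pi.add_apply]
  rw [integral_add h3 h0.abs,
    integral_add (integrable_const _) h1.abs, h2]
  simp [pi_pos.le]
  linarith

lemma poissonKer_nonneg (a t : ℝ) {b : ℝ} (hb : 0 ≤ b) : 0 ≤ poissonKer a b t := by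
  unfold poissonKer; positivity

/-- Averaging the Poisson kernel over the upper unit semicircle. -/
lemma integral_poissonKer_cos_sin {t : ℝ} (h0 : t ≠ 0) (h1 : t ≠ 1) (h2 : t ≠ -1) :
    ∫ θ in Ioo 0 π, poissonKer (cos θ) (sin θ) t = 1 / t * log |(t + 1) / (t - 1)| := by
  have hpos : ∀ θ : ℝ, 0 < (t - cos θ) ^ 2 + sin θ ^ 2 := fun θ => by
    by_contra! h
    have hs : sin θ = 0 := by nlinarith [sq_nonneg (t - cos θ), sq_nonneg (sin θ)]
    have hc : t = cos θ := by nlinarith [sq_nonneg (t - cos θ), sq_nonneg (sin θ)]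
    have : (t - 1) * (t + 1) = 0 := by
      rw [hc]; linear_combination sin_sq_add_cos_sq θ - sin θ * hs
    rcases mul_eq_zero.1 this with h | h
    · exact h1 (by linarith)
    · exact h2 (by linarith)
  have hd : ∀ θ ∈ uIcc 0 π, HasDerivAt
      (fun θ => 1 / (2 * t) * log ((t - cos θ) ^ 2 + sin θ ^ 2))
      (poissonKer (cos θ) (sin θ) t) θ := fun θ _ => by
    have := (((((hasDerivAt_cos θ).const_sub t).pow 2).add ((hasDerivAt_sin θ).pow 2)).log
      (hpos θ).ne').const_mul (1 / (2 * t))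
    refine this.congr_deriv ?_
    have := (hpos θ).ne'
    simp only [poissonKer, Pi.add_apply, Pi.pow_apply]
    field_simp
    push_cast
    ring
  have hcont : Continuous fun θ => poissonKer (cos θ) (sin θ) t := by
    unfold poissonKer
    exact continuous_sin.div (by fun_prop) fun θ => (hpos θ).ne'
  rw [← integral_Ioc_eq_integral_Ioo, ← intervalIntegral.integral_of_le pi_pos.le,
    intervalIntegral.integral_eq_sub_of_hasDerivAt hd (hcont.intervalIntegrable _ _)]
  have e1 : t + 1 ≠ 0 := fun h => h2 (by linarith)
  have e2 : t - 1 ≠ 0 := sub_ne_zero.2 h1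
  simp only [cos_pi, sin_pi, cos_zero, sin_zero, log_abs]
  rw [log_div e1 e2]
  simp only [sub_neg_eq_add, ne_eq, OfNat.ofNat_ne_zero, not_false_eq_true, zero_pow, add_zero,
    log_pow]
  field_simp
  push_cast
  ring

lemma log_norm_circleMap_sub (x θ : ℝ) :
    log ‖circleMap 0 1 θ - x‖ = log ‖(⟨x - cos θ, sin θ⟩ : ℂ)‖ := by
  congr 1
  rw [Complex.norm_eq_sqrt_sq_add_sq, Complex.norm_eq_sqrt_sq_add_sq]
  congr 1
  simp [circleMap, Complex.exp_ofReal_mul_I_re, Complex.exp_ofReal_mul_I_im]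
  ring

lemma intervalIntegrable_log_norm_circle (x : ℝ) :
    IntervalIntegrable (fun θ => log ‖(⟨x - cos θ, sin θ⟩ : ℂ)‖) volume 0 (2 * π) := by
  have h := circleIntegrable_log_norm_sub_const (a := (x : ℂ)) (c := 0) 1
  simpa only [CircleIntegrable, log_norm_circleMap_sub] using h

lemma integrableOn_log_norm_semicircle (x : ℝ) :
    IntegrableOn (fun θ => log ‖(⟨x - cos θ, sin θ⟩ : ℂ)‖) (Ioo 0 π) :=
  ((intervalIntegrable_iff_integrableOn_Ioo_of_le (by positivity)).1
    (intervalIntegrable_log_norm_circle x)).mono_set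
    (Ioo_subset_Ioo_right (by linarith [pi_pos]))

lemma integral_log_norm_semicircle (x : ℝ) :
    ∫ θ in Ioo 0 π, log ‖(⟨x - cos θ, sin θ⟩ : ℂ)‖ = π * max (log |x|) 0 := by
  have h := circleAverage_log_norm_sub_const_eq_posLog (a := (x : ℂ))
  simp only [circleAverage, log_norm_circleMap_sub, posLog, Complex.norm_real, norm_eq_abs,
    smul_eq_mul] at h
  have hi := intervalIntegrable_log_norm_circle x
  have hmem : π ∈ uIcc 0 (2 * π) := by
    rw [mem_uIcc]; left; constructor <;> linarith [pi_pos]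
  have hsymm : ∫ θ in π..2 * π, log ‖(⟨x - cos θ, sin θ⟩ : ℂ)‖ =
      ∫ θ in 0..π, log ‖(⟨x - cos θ, sin θ⟩ : ℂ)‖ := by
    have h := intervalIntegral.integral_comp_sub_left (a := 0) (b := π)
      (fun θ => log ‖(⟨x - cos θ, sin θ⟩ : ℂ)‖) (2 * π)
    rw [show 2 * π - π = π by ring, sub_zero] at h
    rw [← h]
    refine intervalIntegral.integral_congr fun θ _ => ?_
    simp [Complex.norm_eq_sqrt_sq_add_sq, cos_two_pi_sub, sin_two_pi_sub]
  rw [← intervalIntegral.integral_add_adjacent_intervals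
    (hi.mono_set (uIcc_subset_uIcc_left hmem)) (hi.mono_set (uIcc_subset_uIcc_right hmem)),
    hsymm] at h
  rw [← integral_Ioc_eq_integral_Ioo, ← intervalIntegral.integral_of_le pi_pos.le, max_comm, ← h]
  field_simp
  ring

lemma integrable_prod_log_mul_poissonKer (x : ℝ) :
    Integrable (fun p : ℝ × ℝ => log |x - p.2| * poissonKer (cos p.1) (sin p.1) p.2)
      ((volume.restrict (Ioo 0 π)).prod volume) := by
  have hm : AEStronglyMeasurable
      (fun p : ℝ × ℝ => log |x - p.2| * poissonKer (cos p.1) (sin p.1) p.2)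
      ((volume.restrict (Ioo 0 π)).prod volume) := by
    unfold poissonKer
    exact Measurable.aestronglyMeasurable (by fun_prop)
  rw [integrable_prod_iff hm]
  constructor
  · filter_upwards [ae_restrict_mem measurableSet_Ioo] with θ hθ
    exact integrable_log_mul_poissonKer _ _ (sin_pos_of_mem_Ioo hθ)
  · refine Integrable.mono' (((integrableOn_log_norm_semicircle x).abs.const_mul π).add
      (integrable_const (2 * ∫ φ in Ioo (-(π / 2)) (π / 2), |log (cos φ)|)))
      hm.norm.integral_prod_right' ?_
    filter_upwards [ae_restrict_mem measurableSet_Ioo] with θ hθ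
    have hs := sin_pos_of_mem_Ioo hθ
    rw [norm_of_nonneg (by positivity)]
    simp only [norm_mul, norm_eq_abs, abs_of_nonneg (poissonKer_nonneg _ _ hs.le)]
    exact integral_abs_log_mul_poissonKer_le _ _ hs

theorem statement11 (x : ℝ) :
    ∫ z, Real.log |x - z| ∂muR = max (Real.log |x|) 0 := by
  have hae : ∀ᵐ z : ℝ, (1 / (π ^ 2 * z) * log |(z + 1) / (z - 1)|) =
      1 / π ^ 2 * ∫ θ in Ioo 0 π, poissonKer (cos θ) (sin θ) z := by
    filter_upwards [((countable_singleton (-1 : ℝ)).insert 1 |>.insert 0).ae_notMem volume]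
      with z hz
    simp only [mem_insert_iff, mem_singleton_iff, not_or] at hz
    rw [integral_poissonKer_cos_sin hz.1 hz.2.1 hz.2.2, ← mul_assoc, one_div_mul_one_div]
  have hnn : ∀ z, 0 ≤ ∫ θ in Ioo 0 π, poissonKer (cos θ) (sin θ) z := fun z =>
    setIntegral_nonneg measurableSet_Ioo fun θ hθ =>
      poissonKer_nonneg _ _ (sin_pos_of_mem_Ioo hθ).le
  rw [muR, integral_withDensity_eq_integral_toReal_smul (by fun_prop) (by simp)]
  calc _ = ∫ z, 1 / π ^ 2 * ∫ θ in Ioo 0 π, log |x - z| * poissonKer (cos θ) (sin θ) z := by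
        refine integral_congr_ae ?_
        filter_upwards [hae] with z hz
        rw [hz, ENNReal.toReal_ofReal (mul_nonneg (by positivity) (hnn z)), smul_eq_mul,
          integral_const_mul]
        ring
    _ = 1 / π ^ 2 * ∫ θ in Ioo 0 π, ∫ z, log |x - z| * poissonKer (cos θ) (sin θ) z := by
        rw [integral_const_mul, integral_integral_swap]
        exact (integrable_prod_log_mul_poissonKer x).swap
    _ = 1 / π ^ 2 * ∫ θ in Ioo 0 π, π * log ‖(⟨x - cos θ, sin θ⟩ : ℂ)‖ := by
        congr 1
        exact setIntegral_congr_fun measurableSet_Ioo fun θ hθ =>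
          integral_log_mul_poissonKer _ _ (sin_pos_of_mem_Ioo hθ)
    _ = max (log |x|) 0 := by
        rw [integral_const_mul, integral_log_norm_semicircle]
        field_simp
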